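/- arXiv:1908.06542 — 2 statements merged into one kernel-verified Lean document; each statement's English description precedes it below -/
import Mathlib

section
/- Let A be a complex affine Poisson algebra. The following are equivalent: (i) A satisfies the Poisson Dixmier-Moeglin equivalence; (ii) every Poisson primitive ideal of A is locally closed in P.spec A; (iii) every Poisson rational ideal of A is locally closed in P.spec A; (iv) every Poisson prime ideal of A that is |ℂ|-separable in P.spec A is ℵ₀-separable in P.spec A. -/
section Poisson

variable (A : Type) [CommRing A] [Algebra ℂ A]

/-- `I` is a Poisson ideal: `{A, I} ⊆ I`. -/
def IsPoissonIdeal (br : A →ₗ[ℂ] A →ₗ[ℂ] A) (I : Ideal A) : Prop :=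
  ∀ a : A, ∀ x ∈ I, br a x ∈ I

/-- `P` is a Poisson prime ideal: a prime ideal which is a Poisson ideal. -/
def IsPoissonPrime (br : A →ₗ[ℂ] A →ₗ[ℂ] A) (P : Ideal A) : Prop :=
  P.IsPrime ∧ IsPoissonIdeal A br P

/-- The Poisson core of an ideal `J`: the largest Poisson ideal contained in `J`. -/
def poissonCore (br : A →ₗ[ℂ] A →ₗ[ℂ] A) (J : Ideal A) : Ideal A :=
  sSup {I : Ideal A | IsPoissonIdeal A br I ∧ I ≤ J}

/-- `P` is Poisson primitive: it is the Poisson core of some maximal ideal. -/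
def IsPoissonPrimitive (br : A →ₗ[ℂ] A →ₗ[ℂ] A) (P : Ideal A) : Prop :=
  ∃ M : Ideal A, M.IsMaximal ∧ poissonCore A br M = P

/-- `P.spec A`: the set of Poisson prime ideals, topologized as a subspace of `Spec A`. -/
abbrev PoissonSpec (br : A →ₗ[ℂ] A →ₗ[ℂ] A) : Type :=
  {P : PrimeSpectrum A // IsPoissonIdeal A br P.asIdeal}

/-- `P` is Poisson rational: the Poisson center of `Frac(A/P)` is `ℂ`; concretely, whenever
`a, b ∈ A` with `b ∉ P` satisfy `{c, a}·b − a·{c, b} ∈ P` for all `c ∈ A`, the element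
`(a mod P)/(b mod P)` of `Frac(A/P)` lies in `ℂ`. -/
def IsPoissonRational (br : A →ₗ[ℂ] A →ₗ[ℂ] A) (P : Ideal A) (hP : P.IsPrime) : Prop :=
  haveI := hP
  ∀ a b : A, b ∉ P → (∀ c : A, br c a * b - a * br c b ∈ P) →
    ∃ z : ℂ,
      algebraMap (A ⧸ P) (FractionRing (A ⧸ P)) (Ideal.Quotient.mk P a) /
        algebraMap (A ⧸ P) (FractionRing (A ⧸ P)) (Ideal.Quotient.mk P b) =
      algebraMap ℂ (FractionRing (A ⧸ P)) z

/-- `P` is `κ`-separable in `P.spec A`: there is a set `Λ`, of cardinality `< κ`, of Poisson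
prime ideals properly containing `P`, such that every Poisson prime ideal properly containing
`P` contains a member of `Λ`. -/
def PoissonSeparable (br : A →ₗ[ℂ] A →ₗ[ℂ] A) (κ : Cardinal.{0}) (P : Ideal A) : Prop :=
  ∃ Λ : Set (Ideal A), (∀ Q ∈ Λ, IsPoissonPrime A br Q ∧ P < Q) ∧
    Cardinal.mk Λ < κ ∧
    ∀ Q : Ideal A, IsPoissonPrime A br Q → P < Q → ∃ Q' ∈ Λ, Q' ≤ Q

/-- `A` satisfies the Poisson Dixmier–Moeglin equivalence: for every Poisson prime ideal `P`,
the conditions "`{P}` is locally closed in `P.spec A`", "`P` is Poisson primitive", and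
"`P` is Poisson rational" are equivalent. -/
def PoissonDME (br : A →ₗ[ℂ] A →ₗ[ℂ] A) : Prop :=
  ∀ (P : PrimeSpectrum A) (hP : IsPoissonIdeal A br P.asIdeal),
    (IsLocallyClosed ({⟨P, hP⟩} : Set (PoissonSpec A br)) ↔ IsPoissonPrimitive A br P.asIdeal) ∧
    (IsPoissonPrimitive A br P.asIdeal ↔ IsPoissonRational A br P.asIdeal P.isPrime)

end Poisson

namespace PoissonDME

section Derivation

variable {A : Type} [CommRing A] [Algebra ℂ A]

theorem mem_of_nsmul_mem {Q : Ideal A} {n : ℕ} (hn : n ≠ 0) {x : A} (h : n • x ∈ Q) : x ∈ Q := by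
  have h' := Q.mul_mem_left (algebraMap ℂ A (n : ℂ)⁻¹) h
  rwa [← Algebra.smul_def, ← Nat.cast_smul_eq_nsmul ℂ, smul_smul,
    inv_mul_cancel₀ (Nat.cast_ne_zero.mpr hn), one_smul] at h'

variable {δ : A →ₗ[ℂ] A} (hδ : ∀ x y, δ (x * y) = δ x * y + x * δ y) {Q : Ideal A}
include hδ

theorem iterate_mul_mem {k : ℕ} {y : A} (hy : ∀ j ≤ k, δ^[j] y ∈ Q) (z : A) :
    δ^[k] (z * y) ∈ Q := by
  induction k generalizing y z with
  | zero => exact Q.mul_mem_left z (hy 0 le_rfl)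
  | succ k ih =>
    rw [Function.iterate_succ_apply, hδ, iterate_map_add]
    exact Q.add_mem (ih (fun j hj => hy j (by omega)) _)
      (ih (fun j hj => hy (j + 1) (by omega)) _)

theorem iterate_mul_sub_mul_iterate_mem {n : ℕ} {y : A} (hy : ∀ j < n, δ^[j] y ∈ Q) (x : A) :
    δ^[n] (x * y) - x * δ^[n] y ∈ Q := by
  induction n generalizing y x with
  | zero => simp
  | succ n ih =>
    rw [Function.iterate_succ_apply, hδ, iterate_map_add, add_sub_assoc]
    exact Q.add_mem (iterate_mul_mem hδ (fun j hj => hy j (by omega)) _)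
      (ih (fun j hj => hy (j + 1) (by omega)) _)

/-- Modulo an ideal containing the lower iterates, only the middle term of the Leibniz expansion
survives. -/
theorem iterate_mul_sub_choose_mem (m n : ℕ) {x y : A} (hx : ∀ i < m, δ^[i] x ∈ Q)
    (hy : ∀ j < n, δ^[j] y ∈ Q) :
    δ^[m + n] (x * y) - (m + n).choose m • (δ^[m] x * δ^[n] y) ∈ Q := by
  match m, n with
  | 0, n => simpa using iterate_mul_sub_mul_iterate_mem hδ hy x
  | m + 1, 0 => simpa [mul_comm] using iterate_mul_sub_mul_iterate_mem hδ hx y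
  | m + 1, n + 1 =>
    have h1 := iterate_mul_sub_choose_mem m (n + 1) (x := δ x) (y := y)
      (fun i hi => hx (i + 1) (by omega)) hy
    have h2 := iterate_mul_sub_choose_mem (m + 1) n (x := x) (y := δ y) hx
      (fun i hi => hy (i + 1) (by omega))
    have h3 := Q.add_mem h1 h2
    rw [← Function.iterate_succ_apply, ← Function.iterate_succ_apply,
      show m + 1 + n = m + (n + 1) by omega] at h3
    rw [show m + 1 + (n + 1) = m + (n + 1) + 1 by omega, Function.iterate_succ_apply, hδ,
      iterate_map_add, Nat.choose_succ_succ, add_smul]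
    convert h3 using 1
    simp only [Nat.succ_eq_add_one]
    abel
termination_by m + n

/-- A prime ideal minimal over a differential ideal is differential. -/
theorem map_mem_of_mem_minimalPrimes {J : Ideal A} (hJ : ∀ x ∈ J, δ x ∈ J)
    (hQ : Q ∈ J.minimalPrimes) : ∀ x ∈ Q, δ x ∈ Q := by
  classical
  have hQp : Q.IsPrime := hQ.1.1
  let C : Ideal A :=
    { carrier := {x | ∀ n, δ^[n] x ∈ Q}
      add_mem' := fun ha hb n => by rw [iterate_map_add]; exact Q.add_mem (ha n) (hb n)
      zero_mem' := fun n => by rw [iterate_map_zero]; exact Q.zero_mem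
      smul_mem' := fun c x hx n => iterate_mul_mem hδ (fun j _ => hx j) c }
  have hCQ : C ≤ Q := fun x hx => hx 0
  have hCp : C.IsPrime := by
    refine ⟨fun h => hQp.ne_top (top_le_iff.mp (h ▸ hCQ)), fun {x y} hxy => ?_⟩
    by_contra! hcon
    have hx : ∃ n, δ^[n] x ∉ Q := not_forall.mp hcon.1
    have hy : ∃ n, δ^[n] y ∉ Q := not_forall.mp hcon.2
    have h := iterate_mul_sub_choose_mem hδ (Q := Q) (Nat.find hx) (Nat.find hy) (x := x) (y := y)
      (fun i hi => not_not.mp (Nat.find_min hx hi)) (fun i hi => not_not.mp (Nat.find_min hy hi))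
    have h' := (Q.sub_mem_iff_right (hxy (Nat.find hx + Nat.find hy))).mp h
    rcases hQp.mem_or_mem (mem_of_nsmul_mem (Nat.choose_pos (by omega)).ne' h') with h | h
    · exact Nat.find_spec hx h
    · exact Nat.find_spec hy h
  have hJC : J ≤ C := fun x hx n => by
    have : ∀ n, δ^[n] x ∈ J := fun n => by
      induction n with
      | zero => exact hx
      | succ n ih => rw [Function.iterate_succ_apply']; exact hJ _ ih
    exact hQ.1.2 (this n)
  exact fun x hx => hQ.2 ⟨hCp, hJC⟩ hCQ hx 1

end Derivation

section Ideals

variable {A : Type} [CommRing A] [Algebra ℂ A] {br : A →ₗ[ℂ] A →ₗ[ℂ] A}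

theorem isPoissonIdeal_sInf {S : Set (Ideal A)} (hS : ∀ I ∈ S, IsPoissonIdeal A br I) :
    IsPoissonIdeal A br (sInf S) := fun a x hx => by
  rw [Submodule.mem_sInf] at hx ⊢
  exact fun I hI => hS I hI a x (hx I hI)

theorem poissonCore_le (J : Ideal A) : poissonCore A br J ≤ J :=
  sSup_le fun _ h => h.2

theorem le_poissonCore {I J : Ideal A} (hI : IsPoissonIdeal A br I) (h : I ≤ J) :
    I ≤ poissonCore A br J :=
  le_sSup ⟨hI, h⟩

theorem isPoissonIdeal_poissonCore (J : Ideal A) :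
    IsPoissonIdeal A br (poissonCore A br J) := fun a x hx => by
  let D : Submodule ℂ A := ((poissonCore A br J).restrictScalars ℂ).comap (br a)
  rw [poissonCore, sSup_eq_iSup'] at hx
  refine Submodule.iSup_induction _ (motive := fun x => x ∈ D) hx ?_ D.zero_mem
    fun _ _ => D.add_mem
  exact fun I x hxI => le_poissonCore I.2.1 I.2.2 (I.2.1 a x hxI)

variable (hleibniz : ∀ a b c : A, br a (b * c) = br a b * c + b * br a c)
include hleibniz

theorem isPoissonPrime_of_mem_minimalPrimes {J Q : Ideal A} (hJ : IsPoissonIdeal A br J)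
    (hQ : Q ∈ J.minimalPrimes) : IsPoissonPrime A br Q :=
  ⟨hQ.1.1, fun a => map_mem_of_mem_minimalPrimes (hleibniz a) (hJ a) hQ⟩

theorem isPoissonPrime_poissonCore (Q : Ideal A) [Q.IsPrime] :
    IsPoissonPrime A br (poissonCore A br Q) := by
  obtain ⟨Q', hQ', hle⟩ := Ideal.exists_minimalPrimes_le (poissonCore_le (br := br) Q)
  have h := isPoissonPrime_of_mem_minimalPrimes hleibniz (isPoissonIdeal_poissonCore Q) hQ'
  rwa [le_antisymm hQ'.1.2 (le_poissonCore h.2 hle)]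

theorem exists_finite_poissonPrimes [IsNoetherianRing A] {P : Ideal A} {f : A} (hf : f ∉ P) :
    ∃ Λ : Set (Ideal A), Λ.Finite ∧ (∀ Q ∈ Λ, IsPoissonPrime A br Q ∧ P < Q) ∧
      ∀ Q, IsPoissonPrime A br Q → P ≤ Q → f ∈ Q → ∃ Q' ∈ Λ, Q' ≤ Q := by
  let S : Set (Ideal A) := {I | IsPoissonIdeal A br I ∧ P ≤ I ∧ f ∈ I}
  have hS : IsPoissonIdeal A br (sInf S) := isPoissonIdeal_sInf fun I hI => hI.1
  have hPS : P ≤ sInf S := le_sInf fun I hI => hI.2.1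
  have hfS : f ∈ sInf S := Submodule.mem_sInf.mpr fun I hI => hI.2.2
  refine ⟨(sInf S).minimalPrimes, Ideal.finite_minimalPrimes_of_isNoetherianRing A _,
    fun Q hQ => ⟨isPoissonPrime_of_mem_minimalPrimes hleibniz hS hQ,
      lt_of_le_of_ne (hPS.trans hQ.1.2) fun h => hf (h ▸ hQ.1.2 hfS)⟩, fun Q hQ hPQ hfQ => ?_⟩
  have := hQ.1
  exact Ideal.exists_minimalPrimes_le (sInf_le ⟨hQ.2, hPQ, hfQ⟩)

theorem isLocallyClosed_singleton_iff [IsNoetherianRing A] (P : PrimeSpectrum A)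
    (hP : IsPoissonIdeal A br P.asIdeal) :
    IsLocallyClosed ({⟨P, hP⟩} : Set (PoissonSpec A br)) ↔
      PoissonSeparable A br Cardinal.aleph0 P.asIdeal := by
  constructor
  · rintro ⟨U, Z, hU, hZ, hUZ⟩
    have hPUZ : (⟨P, hP⟩ : PoissonSpec A br) ∈ U ∩ Z := hUZ ▸ rfl
    obtain ⟨V, hV, rfl⟩ := isOpen_induced_iff.mp hU
    obtain ⟨_, ⟨f, rfl⟩, hfP, hfV⟩ :=
      PrimeSpectrum.isTopologicalBasis_basic_opens.exists_subset_of_mem_open hPUZ.1 hV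
    have hfP' : f ∉ P.asIdeal := hfP
    obtain ⟨Λ, hfin, hΛ, hsep⟩ := exists_finite_poissonPrimes hleibniz hfP'
    refine ⟨Λ, hΛ, Cardinal.lt_aleph0_iff_set_finite.mpr hfin, fun Q hQ hPQ => ?_⟩
    refine hsep Q hQ hPQ.le (by_contra fun hfQ => hPQ.ne ?_)
    let q : PoissonSpec A br := ⟨⟨Q, hQ.1⟩, hQ.2⟩
    have hspec : (⟨P, hP⟩ : PoissonSpec A br) ⤳ q :=
      Topology.IsInducing.subtypeVal.specializes_iff.mp
        ((PrimeSpectrum.le_iff_specializes _ _).mp hPQ.le)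
    have hq : q ∈ ({⟨P, hP⟩} : Set (PoissonSpec A br)) :=
      hUZ ▸ ⟨hfV hfQ, hspec.mem_closed hZ hPUZ.2⟩
    exact (congrArg (fun x : PoissonSpec A br => x.1.asIdeal) hq).symm
  · rintro ⟨Λ, hΛ, hcard, hsep⟩
    have hfin : Λ.Finite := Cardinal.lt_aleph0_iff_set_finite.mp hcard
    choose! g hgQ hgP using fun Q hQ => SetLike.exists_of_lt (hΛ Q hQ).2
    let f := ∏ Q ∈ hfin.toFinset, g Q
    have hfP : f ∉ P.asIdeal := fun h => by
      obtain ⟨Q, hQ, hQP⟩ := (Ideal.IsPrime.prod_mem_iff).mp h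
      exact hgP Q (hfin.mem_toFinset.mp hQ) hQP
    refine ⟨Subtype.val ⁻¹' (PrimeSpectrum.basicOpen f : Set (PrimeSpectrum A)),
      Subtype.val ⁻¹' PrimeSpectrum.zeroLocus (P.asIdeal : Set A),
      (PrimeSpectrum.basicOpen f).2.preimage continuous_subtype_val,
      (PrimeSpectrum.isClosed_zeroLocus _).preimage continuous_subtype_val, ?_⟩
    ext q
    constructor
    · rintro rfl
      exact ⟨hfP, fun x hx => hx⟩
    · rintro ⟨hfq, hPq⟩
      have hPq' : P.asIdeal ≤ q.1.asIdeal := hPq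
      rcases hPq'.eq_or_lt with h | h
      · exact Subtype.ext (PrimeSpectrum.ext h.symm)
      · obtain ⟨Q, hQ, hQq⟩ := hsep _ ⟨q.1.isPrime, q.2⟩ h
        exact absurd (Ideal.mem_of_dvd _ (Finset.dvd_prod_of_mem g (hfin.mem_toFinset.mpr hQ))
          (hQq (hgQ Q hQ))) hfq

end Ideals

section Cardinality

open Cardinal

theorem rank_adjoin_le {L : Type} [CommRing L] [Algebra ℂ L] (s : Set L) :
    Module.rank ℂ (Algebra.adjoin ℂ s) ≤ max #s ℵ₀ := by
  have h : Module.rank ℂ (MvPolynomial s ℂ) ≤ max #s ℵ₀ := by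
    rw [MvPolynomial.rank_eq_lift, lift_id]
    rcases isEmpty_or_nonempty s with hs | hs
    · refine le_max_of_le_right (le_of_lt ?_)
      exact lt_aleph0_of_finite _
    · rw [mk_finsupp_nat]
  refine le_trans ?_ h
  rw [Algebra.adjoin_eq_range]
  exact LinearMap.rank_le_of_surjective
    (MvPolynomial.aeval (Subtype.val : s → L)).rangeRestrict.toLinearMap
    (MvPolynomial.aeval (Subtype.val : s → L)).rangeRestrict_surjective

theorem rank_le_aleph0 (B : Type) [CommRing B] [Algebra ℂ B] [h : Algebra.FiniteType ℂ B] :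
    Module.rank ℂ B ≤ ℵ₀ := by
  obtain ⟨s, hs⟩ := h.out
  have h := rank_adjoin_le (s : Set B)
  rw [hs, max_eq_right (lt_aleph0_of_finite _).le] at h
  exact (Subalgebra.topEquiv (R := ℂ) (A := B)).toLinearEquiv.rank_eq ▸ h

theorem algebraMap_surjective_of_rank_lt (F : Type) [Field F] [Algebra ℂ F]
    (h : Module.rank ℂ F < #ℂ) : Function.Surjective (algebraMap ℂ F) := by
  have : Algebra.IsAlgebraic ℂ F := ⟨fun x => by
    by_contra hx
    exact h.not_ge (Transcendental.linearIndependent_sub_inv hx).cardinal_le_rank⟩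
  exact (IsAlgClosed.algebraMap_bijective_of_isIntegral).surjective

/-- An irreducible affine variety over `ℂ` is not covered by fewer than `#ℂ` proper
hypersurfaces. -/
theorem exists_isMaximal_of_card_lt {A : Type} [CommRing A] [Algebra ℂ A]
    [hA : Algebra.FiniteType ℂ A] (P : Ideal A) [P.IsPrime] (G : Set A) (hG : #G < #ℂ)
    (hGP : ∀ g ∈ G, g ∉ P) :
    ∃ M : Ideal A, M.IsMaximal ∧ P ≤ M ∧ ∀ g ∈ G, g ∉ M := by
  obtain ⟨s, hs⟩ := hA.out
  let L := FractionRing (A ⧸ P)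
  let φ : A →ₐ[ℂ] L := (IsScalarTower.toAlgHom ℂ (A ⧸ P) L).comp (Ideal.Quotient.mkₐ ℂ P)
  have hφ : ∀ a, φ a = 0 ↔ a ∈ P := fun a => by
    change algebraMap (A ⧸ P) L (Ideal.Quotient.mk P a) = 0 ↔ _
    rw [FaithfulSMul.algebraMap_eq_zero_iff, Ideal.Quotient.eq_zero_iff_mem]
  let T : Set L := φ '' s ∪ (fun g => (φ g)⁻¹) '' G
  let C := Algebra.adjoin ℂ T
  have hφC : ∀ a, φ a ∈ C := by
    have : (⊤ : Subalgebra ℂ A) ≤ C.comap φ := by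
      rw [← hs, Algebra.adjoin_le_iff]
      exact fun a ha => Algebra.subset_adjoin (Or.inl ⟨a, ha, rfl⟩)
    exact fun a => this trivial
  obtain ⟨N, hN⟩ := Ideal.exists_maximal C
  let _ : Field (C ⧸ N) := Ideal.Quotient.field N
  have hTcard : max #T ℵ₀ < #ℂ := by
    have hℵ : ℵ₀ < #ℂ := mk_complex ▸ aleph0_lt_continuum
    refine max_lt (lt_of_le_of_lt (mk_union_le _ _) (add_lt_of_lt hℵ.le ?_ ?_)) hℵ
    · exact (lt_aleph0_iff_set_finite.mpr (s.finite_toSet.image φ)).trans hℵ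
    · exact mk_image_le.trans_lt hG
  have hsurj : Function.Surjective (algebraMap ℂ (C ⧸ N)) :=
    algebraMap_surjective_of_rank_lt _ <|
      ((LinearMap.rank_le_of_surjective (Ideal.Quotient.mkₐ ℂ N).toLinearMap
        (Ideal.Quotient.mkₐ_surjective ℂ N)).trans (rank_adjoin_le T)).trans_lt hTcard
  let ψ : A →ₐ[ℂ] C ⧸ N := (Ideal.Quotient.mkₐ ℂ N).comp (φ.codRestrict C hφC)
  have hψ : Function.Surjective ψ := fun y => by
    obtain ⟨z, rfl⟩ := hsurj y
    exact ⟨algebraMap ℂ A z, ψ.commutes z⟩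
  refine ⟨RingHom.ker ψ, RingHom.ker_isMaximal_of_surjective ψ hψ, fun a ha => ?_,
    fun g hg hgM => ?_⟩
  · rw [RingHom.mem_ker]
    have : φ.codRestrict C hφC a = 0 := Subtype.ext ((hφ a).mpr ha)
    change Ideal.Quotient.mkₐ ℂ N (φ.codRestrict C hφC a) = 0
    rw [this, map_zero]
  · have hmem : φ.codRestrict C hφC g ∈ N := Ideal.Quotient.eq_zero_iff_mem.mp hgM
    refine hN.ne_top ((Ideal.eq_top_iff_one N).mpr ?_)
    have hinv : (φ g)⁻¹ ∈ C := Algebra.subset_adjoin (Or.inr ⟨g, hg, rfl⟩)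
    have h1 : φ.codRestrict C hφC g * ⟨(φ g)⁻¹, hinv⟩ = 1 :=
      Subtype.ext (mul_inv_cancel₀ fun h => hGP g hg ((hφ g).mp h))
    exact h1 ▸ N.mul_mem_right _ hmem

end Cardinality

section Rational

open Cardinal

variable {A : Type} [CommRing A] [Algebra ℂ A] {br : A →ₗ[ℂ] A →ₗ[ℂ] A}

theorem isPoissonRational_iff {P : Ideal A} (hP : P.IsPrime) :
    IsPoissonRational A br P hP ↔ ∀ a b : A, b ∉ P → (∀ c, br c a * b - a * br c b ∈ P) →
      ∃ z : ℂ, a - z • b ∈ P := by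
  refine forall₄_congr fun a b hb _ => exists_congr fun z => ?_
  have hb' : algebraMap (A ⧸ P) (FractionRing (A ⧸ P)) (Ideal.Quotient.mk P b) ≠ 0 := by
    rwa [Ne, FaithfulSMul.algebraMap_eq_zero_iff, Ideal.Quotient.eq_zero_iff_mem]
  rw [div_eq_iff hb', IsScalarTower.algebraMap_apply ℂ (A ⧸ P) (FractionRing (A ⧸ P)), ← map_mul,
    (FaithfulSMul.algebraMap_injective (A ⧸ P) (FractionRing (A ⧸ P))).eq_iff,
    ← Ideal.Quotient.eq, Algebra.smul_def, map_mul]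
  rfl

variable (hleibniz : ∀ a b c : A, br a (b * c) = br a b * c + b * br a c)
include hleibniz

theorem isPoissonPrimitive_of_separable [Algebra.FiniteType ℂ A] {P : Ideal A}
    (hP : IsPoissonPrime A br P) (h : PoissonSeparable A br #ℂ P) :
    IsPoissonPrimitive A br P := by
  obtain ⟨Λ, hΛ, hcard, hsep⟩ := h
  have := hP.1
  choose! g hgQ hgP using fun Q hQ => SetLike.exists_of_lt (hΛ Q hQ).2
  obtain ⟨M, hM, hPM, hgM⟩ := exists_isMaximal_of_card_lt P (g '' Λ) (mk_image_le.trans_lt hcard)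
    (by rintro _ ⟨Q, hQ, rfl⟩; exact hgP Q hQ)
  refine ⟨M, hM, by_contra fun hne => ?_⟩
  have := hM.isPrime
  obtain ⟨Q, hQ, hle⟩ := hsep _ (isPoissonPrime_poissonCore hleibniz M)
    (lt_of_le_of_ne (le_poissonCore hP.2 hPM) (Ne.symm hne))
  exact hgM _ ⟨Q, hQ, rfl⟩ (poissonCore_le M (hle (hgQ Q hQ)))

theorem isPoissonRational_of_isPoissonPrimitive [Algebra.FiniteType ℂ A] {P : Ideal A}
    (hP : IsPoissonPrime A br P) (h : IsPoissonPrimitive A br P) :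
    IsPoissonRational A br P hP.1 := by
  rw [isPoissonRational_iff]
  intro a b hb hab
  obtain ⟨M, hM, rfl⟩ := h
  set P := poissonCore A br M
  have hPp := hP.1
  -- the ideal of denominators of `a / b`
  let D : Ideal A :=
    { carrier := {d | ∃ e, d * a - e * b ∈ P}
      add_mem' := by
        rintro d d' ⟨e, h⟩ ⟨e', h'⟩
        exact ⟨e + e', by convert P.add_mem h h' using 1; ring⟩
      zero_mem' := ⟨0, by simp⟩
      smul_mem' := by
        rintro c d ⟨e, h⟩
        exact ⟨c * e, by convert P.mul_mem_left c h using 1; simp only [smul_eq_mul]; ring⟩ }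
  have hD : IsPoissonIdeal A br D := by
    rintro c d ⟨e, h⟩
    refine ⟨br c e, (hPp.mem_or_mem (?_ : b * _ ∈ P)).resolve_left hb⟩
    have h1 := hP.2 c _ h
    rw [map_sub, hleibniz, hleibniz] at h1
    have h2 := P.sub_mem (P.sub_mem (P.mul_mem_left b h1) (P.mul_mem_left d (hab c)))
      (P.mul_mem_left (br c b) h)
    convert h2 using 1
    ring
  obtain ⟨d, ⟨e, hde⟩, hdM⟩ : ∃ d ∈ D, d ∉ M := by
    by_contra! hcon
    exact hb (le_poissonCore hD hcon ⟨a, by simp [mul_comm]⟩)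
  -- the value at `M` of `a / b = e / d`
  obtain ⟨z, hz⟩ : ∃ z : ℂ, e - z • d ∈ M := by
    let _ : Field (A ⧸ M) := Ideal.Quotient.field M
    have hsurj : Function.Surjective (algebraMap ℂ (A ⧸ M)) :=
      algebraMap_surjective_of_rank_lt _
        ((rank_le_aleph0 _).trans_lt (mk_complex ▸ aleph0_lt_continuum))
    obtain ⟨z, hz⟩ := hsurj (Ideal.Quotient.mk M e / Ideal.Quotient.mk M d)
    refine ⟨z, Ideal.Quotient.eq.mp ?_⟩
    have hd : Ideal.Quotient.mk M d ≠ 0 := fun h => hdM (Ideal.Quotient.eq_zero_iff_mem.mp h)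
    rw [Algebra.smul_def, map_mul, ← Ideal.Quotient.algebraMap_eq,
      ← IsScalarTower.algebraMap_apply, hz, Ideal.Quotient.algebraMap_eq, div_mul_cancel₀ _ hd]
  set g := e - z • d with hg
  have hbr : ∀ c, br c g * d - g * br c d ∈ P := by
    intro c
    have h1 := hP.2 c _ hde
    rw [map_sub, hleibniz, hleibniz] at h1
    have key : b * (b * (br c e * d - e * br c d)) ∈ P := by
      have h2 := P.sub_mem (P.sub_mem (P.mul_mem_left (d * d) (hab c))
        (P.mul_mem_left (b * d) h1)) (P.mul_mem_left (- b * br c d - d * br c b) hde)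
      convert h2 using 1
      ring
    have h3 := (hPp.mem_or_mem ((hPp.mem_or_mem key).resolve_left hb)).resolve_left hb
    convert h3 using 1
    rw [hg, map_sub, map_smul]
    simp only [Algebra.smul_def]
    ring
  -- the contraction of `g A_M` along localisation at `M`, modulo `P`
  let I : Ideal A :=
    { carrier := {x | ∃ s ∉ M, ∃ y, s * x - g * y ∈ P}
      add_mem' := by
        rintro x x' ⟨s, hs, y, h⟩ ⟨s', hs', y', h'⟩
        refine ⟨s * s', fun hss => (hM.isPrime.mem_or_mem hss).elim hs hs', s' * y + s * y', ?_⟩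
        convert P.add_mem (P.mul_mem_left s' h) (P.mul_mem_left s h') using 1
        ring
      zero_mem' := ⟨d, hdM, 0, by simp⟩
      smul_mem' := by
        rintro c x ⟨s, hs, y, h⟩
        refine ⟨s, hs, c * y, ?_⟩
        convert P.mul_mem_left c h using 1
        simp only [smul_eq_mul]
        ring }
  have hI : IsPoissonIdeal A br I := by
    rintro c x ⟨s, hs, y, h⟩
    have h1 := hP.2 c _ h
    rw [map_sub, hleibniz, hleibniz] at h1
    refine ⟨s * s * d, fun hss => ?_, s * d * br c y + s * br c d * y - d * br c s * y, ?_⟩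
    · rcases hM.isPrime.mem_or_mem hss with hss | hss
      · exact (hM.isPrime.mem_or_mem hss).elim hs hs
      · exact hdM hss
    · convert P.add_mem (P.add_mem (P.mul_mem_left (s * d) h1)
        (P.mul_mem_left (-(d * br c s)) h)) (P.mul_mem_left (s * y) (hbr c)) using 1
      ring
  have hIM : I ≤ M := by
    rintro x ⟨s, hs, y, h⟩
    have h1 := M.add_mem (poissonCore_le M h) (M.mul_mem_right y hz)
    rw [sub_add_cancel] at h1
    exact (hM.isPrime.mem_or_mem h1).resolve_left hs
  have hgP : g ∈ P :=
    le_poissonCore hI hIM ⟨d, hdM, d, by rw [mul_comm, sub_self]; exact P.zero_mem⟩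
  refine ⟨z, (hPp.mem_or_mem (?_ : d * _ ∈ P)).resolve_left fun h => hdM (poissonCore_le M h)⟩
  convert P.add_mem hde (P.mul_mem_left b hgP) using 1
  rw [hg]
  simp only [Algebra.smul_def]
  ring

/-- Relations modulo `P` satisfied by a family `u` that is linearly independent over the Poisson
centre `ℂ` of `Frac (A / P)`, together with all its Hamiltonian derivatives, are trivial. -/
theorem relation_mem {P : Ideal A} (hP : IsPoissonPrime A br P)
    (hrat : IsPoissonRational A br P hP.1) {ι : Type} [Finite ι] {u : ι → A}
    (hu : ∀ z : ι → ℂ, ∑ᶠ i, z i • u i ∈ P → z = 0) {W : Submodule A (ι → A)}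
    (huW : u ∈ W) (hW : ∀ c, ∀ w ∈ W, (fun i => br c (w i)) ∈ W) {a : ι → A}
    (ha : ∀ w ∈ W, ∑ᶠ i, a i * w i ∈ P) (i : ι) : a i ∈ P := by
  classical
  have := Fintype.ofFinite ι
  simp only [finsum_eq_sum_of_fintype] at hu ha
  have hPp := hP.1
  rw [isPoissonRational_iff] at hrat
  let supp : (ι → A) → Finset ι := fun a => {i | a i ∉ P}
  suffices h : ∀ (n : ℕ) (a : ι → A), (∀ w ∈ W, ∑ i, a i * w i ∈ P) → (supp a).card = n →
      ∀ i, a i ∈ P from h _ a ha rfl i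
  intro n
  induction n using Nat.strong_induction_on with
  | _ n ih =>
  intro a ha hn
  by_contra! hcon
  obtain ⟨i₀, hi₀⟩ := hcon
  have hconst : ∀ c i, br c (a i) * a i₀ - a i * br c (a i₀) ∈ P := by
    intro c
    refine ih _ ?_ (fun i => br c (a i) * a i₀ - a i * br c (a i₀)) (fun w hw => ?_) rfl
    · rw [← hn]
      refine Finset.card_lt_card ⟨fun i hi => ?_, fun h => ?_⟩
      · simp only [supp, Finset.mem_filter, Finset.mem_univ, true_and] at hi ⊢
        exact fun h => hi (P.sub_mem (P.mul_mem_right _ (hP.2 c _ h)) (P.mul_mem_right _ h))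
      · have h' := h (show i₀ ∈ supp a by simpa [supp] using hi₀)
        simp only [supp, Finset.mem_filter, Finset.mem_univ, true_and] at h'
        exact h' (by rw [mul_comm, sub_self]; exact P.zero_mem)
    · have h1 := hP.2 c _ (ha w hw)
      have h2 := ha _ (hW c w hw)
      rw [map_sum] at h1
      simp only [hleibniz, Finset.sum_add_distrib] at h1
      have h3 := P.sub_mem (P.mul_mem_left (a i₀) ((P.add_mem_iff_left h2).mp h1))
        (P.mul_mem_left (br c (a i₀)) (ha w hw))
      convert h3 using 1
      rw [Finset.mul_sum, Finset.mul_sum, ← Finset.sum_sub_distrib]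
      exact Finset.sum_congr rfl fun i _ => by ring
  choose z hz using fun i => hrat (a i) (a i₀) hi₀ (fun c => hconst c i)
  have h0 : z = 0 := by
    refine hu z ((hPp.mem_or_mem (?_ : a i₀ * _ ∈ P)).resolve_left hi₀)
    have h1 := P.sub_mem (ha u huW)
      (P.sum_mem (t := Finset.univ) fun i _ => P.mul_mem_right (u i) (hz i))
    convert h1 using 1
    rw [Finset.mul_sum, ← Finset.sum_sub_distrib]
    exact Finset.sum_congr rfl fun i _ => by simp only [Algebra.smul_def]; ring
  exact hi₀ (by simpa [h0] using hz i₀)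

/-- A form of the Jacobson density theorem for the module `Frac (A / P)` over the algebra generated
by multiplications and Hamiltonian derivations. -/
theorem exists_single_mem {P : Ideal A} (hP : IsPoissonPrime A br P)
    (hrat : IsPoissonRational A br P hP.1) {ι : Type} [Finite ι] [DecidableEq ι] {u : ι → A}
    (hu : ∀ z : ι → ℂ, ∑ᶠ i, z i • u i ∈ P → z = 0) {W : Submodule A (ι → A)}
    (huW : u ∈ W) (hW : ∀ c, ∀ w ∈ W, (fun i => br c (w i)) ∈ W)
    (hPW : ∀ w : ι → A, (∀ i, w i ∈ P) → w ∈ W) (i₀ : ι) :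
    ∃ g ∉ P, Pi.single i₀ g ∈ W := by
  have := Fintype.ofFinite ι
  have hPp := hP.1
  let K := FractionRing (A ⧸ P)
  let φ : A →+* K := (algebraMap (A ⧸ P) K).comp (Ideal.Quotient.mk P)
  have hφ : ∀ a, φ a = 0 ↔ a ∈ P := fun a => by
    change algebraMap (A ⧸ P) K (Ideal.Quotient.mk P a) = 0 ↔ _
    rw [FaithfulSMul.algebraMap_eq_zero_iff, Ideal.Quotient.eq_zero_iff_mem]
  have hden : ∀ k : K, ∃ b ∉ P, ∃ a, φ b * k = φ a := by
    intro k
    obtain ⟨⟨x, y⟩, hxy⟩ := IsLocalization.surj (nonZeroDivisors (A ⧸ P)) k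
    obtain ⟨a, rfl⟩ := Ideal.Quotient.mk_surjective x
    obtain ⟨b, hb⟩ := Ideal.Quotient.mk_surjective (y : A ⧸ P)
    refine ⟨b, fun h => nonZeroDivisors.coe_ne_zero y ?_, a, ?_⟩
    · rw [← hb, Ideal.Quotient.eq_zero_iff_mem.mpr h]
    · simpa [φ, mul_comm, hb] using hxy
  let V : Submodule K (ι → K) := Submodule.span K ((fun w i => φ (w i)) '' (W : Set (ι → A)))
  have hV : V = ⊤ := by
    by_contra hne
    obtain ⟨f, hf0, hf⟩ := V.exists_le_ker_of_lt_top (lt_top_iff_ne_top.mpr hne)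
    choose b hb a hab using fun i => hden (f (Pi.single i 1))
    let B := ∏ i, b i
    have hB : B ∉ P := fun h => by
      obtain ⟨i, -, hi⟩ := (Ideal.IsPrime.prod_mem_iff).mp h
      exact hb i hi
    let a' : ι → A := fun i => (∏ j ∈ Finset.univ.erase i, b j) * a i
    have ha' : ∀ i, φ (a' i) = φ B * f (Pi.single i 1) := fun i => by
      rw [map_mul, ← hab, ← mul_assoc, ← map_mul, Finset.prod_erase_mul _ _ (Finset.mem_univ i)]
    have hsingle : ∀ i : ι, (fun j => if i = j then (1 : K) else 0) = Pi.single i 1 := fun i => by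
      ext j
      simp [Pi.single_apply, eq_comm]
    have hrel := relation_mem hleibniz hP hrat hu huW hW (a := a') (fun w hw => by
      rw [finsum_eq_sum_of_fintype, ← hφ, map_sum]
      have h1 : f (fun i => φ (w i)) = 0 := hf (Submodule.subset_span ⟨w, hw, rfl⟩)
      rw [LinearMap.pi_apply_eq_sum_univ] at h1
      rw [← mul_zero (φ B), ← h1, Finset.mul_sum]
      refine Finset.sum_congr rfl fun i _ => ?_
      rw [map_mul, ha', smul_eq_mul, hsingle]
      ring)
    refine hf0 (LinearMap.pi_ext' fun i => LinearMap.ext_ring ?_)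
    have h := (hφ _).mpr (hrel i)
    rw [ha', mul_eq_zero, hφ] at h
    exact h.resolve_left hB
  have hmem : ∀ v ∈ V, ∃ b ∉ P, ∃ w ∈ W, ∀ i, φ b * v i = φ (w i) := by
    intro v hv
    induction hv using Submodule.span_induction with
    | mem v hv =>
      obtain ⟨w, hw, rfl⟩ := hv
      exact ⟨1, fun h => hPp.ne_top ((Ideal.eq_top_iff_one P).mpr h), w, hw, fun i => by simp⟩
    | zero =>
      exact ⟨1, fun h => hPp.ne_top ((Ideal.eq_top_iff_one P).mpr h), 0, W.zero_mem,
        fun i => by simp⟩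
    | add v v' _ _ h h' =>
      obtain ⟨b, hb, w, hw, h⟩ := h
      obtain ⟨b', hb', w', hw', h'⟩ := h'
      refine ⟨b * b', fun hbb => (hPp.mem_or_mem hbb).elim hb hb', b' • w + b • w',
        W.add_mem (W.smul_mem _ hw) (W.smul_mem _ hw'), fun i => ?_⟩
      simp only [Pi.add_apply, Pi.smul_apply, smul_eq_mul, map_add, map_mul, ← h, ← h']
      ring
    | smul k v _ h =>
      obtain ⟨b, hb, w, hw, h⟩ := h
      obtain ⟨b', hb', a, ha⟩ := hden k
      refine ⟨b * b', fun hbb => (hPp.mem_or_mem hbb).elim hb hb', a • w, W.smul_mem _ hw,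
        fun i => ?_⟩
      simp only [Pi.smul_apply, smul_eq_mul, map_mul, ← h, ← ha]
      ring
  obtain ⟨b, hb, w, hw, h⟩ := hmem (Pi.single i₀ 1) (hV ▸ trivial)
  refine ⟨b, hb, ?_⟩
  rw [← sub_add_cancel (Pi.single i₀ b) w]
  refine W.add_mem (hPW _ fun i => ?_) hw
  rw [← hφ, Pi.sub_apply, map_sub, ← h, sub_eq_zero]
  rcases eq_or_ne i i₀ with rfl | hi
  · simp
  · simp [hi]

theorem exists_countable_of_isPoissonRational [Algebra.FiniteType ℂ A] {P : Ideal A}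
    (hP : IsPoissonPrime A br P) (hrat : IsPoissonRational A br P hP.1) :
    ∃ G : Set A, G.Countable ∧ (∀ g ∈ G, g ∉ P) ∧
      ∀ Q, IsPoissonIdeal A br Q → P < Q → ∃ g ∈ G, g ∈ Q := by
  classical
  let κ := Module.Free.ChooseBasisIndex ℂ (A ⧸ P)
  let e : Module.Basis κ ℂ (A ⧸ P) := Module.Free.chooseBasis ℂ (A ⧸ P)
  have : Countable κ := by
    rw [← mk_le_aleph0_iff, e.mk_eq_rank'']
    exact rank_le_aleph0 _
  choose u hu using fun k => Ideal.Quotient.mk_surjective (e k)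
  have key : ∀ p : (S : Finset κ) × S, ∃ g ∉ P, ∀ Q, IsPoissonIdeal A br Q → P ≤ Q →
      ∀ z : κ → ℂ, z p.2 ≠ 0 → ∑ k ∈ p.1, z k • u k ∈ Q → g ∈ Q := by
    rintro ⟨S, i₀⟩
    let W : Submodule A (S → A) :=
      { carrier := {w | ∀ Q, IsPoissonIdeal A br Q → P ≤ Q → ∀ z : S → ℂ,
          ∑ k, z k • u k ∈ Q → ∑ k, z k • w k ∈ Q}
        add_mem' := fun h h' Q hQ hPQ z hz => by
          simp only [Pi.add_apply, smul_add, Finset.sum_add_distrib]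
          exact Q.add_mem (h Q hQ hPQ z hz) (h' Q hQ hPQ z hz)
        zero_mem' := fun Q hQ hPQ z hz => by simp
        smul_mem' := fun c w h Q hQ hPQ z hz => by
          convert Q.mul_mem_left c (h Q hQ hPQ z hz) using 1
          rw [Finset.mul_sum]
          exact Finset.sum_congr rfl fun k _ => by simp }
    obtain ⟨g, hg, hgW⟩ := exists_single_mem hleibniz hP hrat (u := fun k : S => u k) (W := W)
      (fun z hz => by
        rw [finsum_eq_sum_of_fintype, ← Ideal.Quotient.eq_zero_iff_mem, ← Ideal.Quotient.mkₐ_eq_mk ℂ,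
          map_sum] at hz
        simp only [map_smul, Ideal.Quotient.mkₐ_eq_mk, hu] at hz
        have hli := e.linearIndependent.comp (Subtype.val : S → κ) Subtype.val_injective
        exact funext (Fintype.linearIndependent_iff.mp hli z hz))
      (fun Q hQ hPQ z hz => hz)
      (fun c w hw Q hQ hPQ z hz => by
        simpa [map_sum] using hQ c _ (hw Q hQ hPQ z hz))
      (fun w hw Q hQ hPQ z _ => Q.sum_mem fun k _ => by
        rw [Algebra.smul_def]
        exact Q.mul_mem_left _ (hPQ (hw k))) i₀
    refine ⟨g, hg, fun Q hQ hPQ z hz hzQ => ?_⟩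
    have h := hgW Q hQ hPQ (fun k => z k) (by rwa [← Finset.sum_coe_sort] at hzQ)
    rw [Finset.sum_eq_single i₀ (fun k _ hk => by simp [hk]) (by simp), Pi.single_eq_same,
      Algebra.smul_def] at h
    have h' := Q.mul_mem_left (algebraMap ℂ A (z i₀)⁻¹) h
    rwa [← mul_assoc, ← map_mul, inv_mul_cancel₀ hz, map_one, one_mul] at h'
  choose g hgP hg using key
  refine ⟨Set.range g, Set.countable_range g, by rintro _ ⟨p, rfl⟩; exact hgP p,
    fun Q hQ hPQ => ?_⟩
  obtain ⟨x, hxQ, hxP⟩ := SetLike.exists_of_lt hPQ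
  let r := e.repr (Ideal.Quotient.mk P x)
  have hr : r ≠ 0 := fun h => hxP <| Ideal.Quotient.eq_zero_iff_mem.mp <|
    e.repr.map_eq_zero_iff.mp h
  obtain ⟨k, hk⟩ := Finsupp.support_nonempty_iff.mpr hr
  refine ⟨_, ⟨⟨r.support, k, hk⟩, rfl⟩, hg _ Q hQ hPQ.le r (Finsupp.mem_support_iff.mp hk) ?_⟩
  have hx : x - ∑ k ∈ r.support, r k • u k ∈ P := by
    rw [← Ideal.Quotient.eq_zero_iff_mem, ← Ideal.Quotient.mkₐ_eq_mk ℂ, map_sub, map_sum, sub_eq_zero]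
    simp only [map_smul, Ideal.Quotient.mkₐ_eq_mk, hu]
    exact (e.linearCombination_repr _).symm
  exact (Q.sub_mem_iff_right hxQ).mp (hPQ.le hx)

theorem separable_of_isPoissonRational [Algebra.FiniteType ℂ A] {P : Ideal A}
    (hP : IsPoissonPrime A br P) (hrat : IsPoissonRational A br P hP.1) :
    PoissonSeparable A br #ℂ P := by
  have := Algebra.FiniteType.isNoetherianRing ℂ A
  obtain ⟨G, hG, hGP, hsep⟩ := exists_countable_of_isPoissonRational hleibniz hP hrat
  choose! Λ hfin hΛ hmin using fun g hg =>
    exists_finite_poissonPrimes (br := br) hleibniz (hGP g hg)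
  refine ⟨⋃ g ∈ G, Λ g, fun Q hQ => ?_, ?_, fun Q hQ hPQ => ?_⟩
  · obtain ⟨g, hg, hQ⟩ := Set.mem_iUnion₂.mp hQ
    exact hΛ g hg Q hQ
  · exact (le_aleph0_iff_set_countable.mpr
      (hG.biUnion fun g hg => (hfin g hg).countable)).trans_lt (mk_complex ▸ aleph0_lt_continuum)
  · obtain ⟨g, hg, hgQ⟩ := hsep Q hQ.2 hPQ
    obtain ⟨Q', hQ', hle⟩ := hmin g hg Q hQ hPQ.le hgQ
    exact ⟨Q', Set.mem_iUnion₂.mpr ⟨g, hg, hQ'⟩, hle⟩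

end Rational

end PoissonDME

/-- Topological characterizations of the Poisson Dixmier–Moeglin equivalence for a complex affine
Poisson algebra. -/
theorem poissonDME_tfae (A : Type) [CommRing A] [Algebra ℂ A] [Algebra.FiniteType ℂ A]
    (br : A →ₗ[ℂ] A →ₗ[ℂ] A)
    (hanti : ∀ a b : A, br a b = -br b a)
    (hjacobi : ∀ a b c : A, br a (br b c) = br (br a b) c + br b (br a c))
    (hleibniz : ∀ a b c : A, br a (b * c) = br a b * c + b * br a c) :
    List.TFAE [
      PoissonDME A br,
      ∀ (P : PrimeSpectrum A) (hP : IsPoissonIdeal A br P.asIdeal),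
        IsPoissonPrimitive A br P.asIdeal →
        IsLocallyClosed ({⟨P, hP⟩} : Set (PoissonSpec A br)),
      ∀ (P : PrimeSpectrum A) (hP : IsPoissonIdeal A br P.asIdeal),
        IsPoissonRational A br P.asIdeal P.isPrime →
        IsLocallyClosed ({⟨P, hP⟩} : Set (PoissonSpec A br)),
      ∀ P : Ideal A, IsPoissonPrime A br P →
        PoissonSeparable A br (Cardinal.mk ℂ) P → PoissonSeparable A br Cardinal.aleph0 P] := by
  have := Algebra.FiniteType.isNoetherianRing ℂ A
  have hlc := PoissonDME.isLocallyClosed_singleton_iff (br := br) hleibniz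
  have hsep : ∀ P : Ideal A, PoissonSeparable A br Cardinal.aleph0 P →
      PoissonSeparable A br (Cardinal.mk ℂ) P := fun P ⟨Λ, h1, h2, h3⟩ =>
    ⟨Λ, h1, h2.trans (Cardinal.mk_complex ▸ Cardinal.aleph0_lt_continuum), h3⟩
  have hprim : ∀ (P : PrimeSpectrum A), IsPoissonIdeal A br P.asIdeal →
      PoissonSeparable A br (Cardinal.mk ℂ) P.asIdeal → IsPoissonPrimitive A br P.asIdeal :=
    fun P hP => PoissonDME.isPoissonPrimitive_of_separable hleibniz ⟨P.isPrime, hP⟩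
  have hrat : ∀ (P : PrimeSpectrum A), IsPoissonIdeal A br P.asIdeal →
      IsPoissonPrimitive A br P.asIdeal → IsPoissonRational A br P.asIdeal P.isPrime :=
    fun P hP => PoissonDME.isPoissonRational_of_isPoissonPrimitive hleibniz ⟨P.isPrime, hP⟩
  have hratsep : ∀ (P : PrimeSpectrum A), IsPoissonIdeal A br P.asIdeal →
      IsPoissonRational A br P.asIdeal P.isPrime →
        PoissonSeparable A br (Cardinal.mk ℂ) P.asIdeal :=
    fun P hP => PoissonDME.separable_of_isPoissonRational hleibniz ⟨P.isPrime, hP⟩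
  tfae_have 1 → 2 := fun h P hP => (h P hP).1.mpr
  tfae_have 2 → 3 := fun h P hP hr => h P hP (hprim P hP (hratsep P hP hr))
  tfae_have 3 → 4 := fun h P hP hs =>
    (hlc ⟨P, hP.1⟩ hP.2).mp (h ⟨P, hP.1⟩ hP.2 (hrat ⟨P, hP.1⟩ hP.2 (hprim ⟨P, hP.1⟩ hP.2 hs)))
  tfae_have 4 → 1 := fun h P hP =>
    ⟨⟨fun hl => hprim P hP (hsep _ ((hlc P hP).mp hl)),
      fun hp => (hlc P hP).mpr (h _ ⟨P.isPrime, hP⟩ (hratsep P hP (hrat P hP hp)))⟩,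
      hrat P hP, fun hr => hprim P hP (hratsep P hP hr)⟩
  tfae_finish
end

section
/- Let A be a complex affine Poisson algebra. The map π_m : Max A → P.prim A sending a maximal ideal m to its Poisson core P(m) is a continuous surjection, and P.prim A is a topological quotient of Max A via π_m: a subset X ⊆ P.prim A is closed in P.prim A if and only if π_m^{-1}(X) is closed in Max A. -/
open scoped Nat Topology

namespace Derivation

variable {A : Type} [CommRing A] [Algebra ℂ A] (D : Derivation ℂ A A)

theorem iterate_mul (n : ℕ) (f g : A) :
    D^[n] (f * g) =
      ∑ ij ∈ Finset.HasAntidiagonal.antidiagonal n,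
        (n.choose ij.1 : A) * (D^[ij.1] f * D^[ij.2] g) := by
  induction n with
  | zero => simp
  | succ n ih =>
    rw [Function.iterate_succ_apply', ih,
      Finset.sum_antidiagonal_choose_succ_mul (fun i j => D^[i] f * D^[j] g), map_sum,
      ← Finset.sum_add_distrib]
    refine Finset.sum_congr rfl fun ij hij => ?_
    rw [← Nat.choose_symm_of_eq_add (Finset.HasAntidiagonal.mem_antidiagonal.mp hij).symm]
    simp only [leibniz, smul_eq_mul, Function.iterate_succ_apply', map_natCast]
    ring

theorem iterate_succ_algebraMap (n : ℕ) (c : ℂ) : D^[n + 1] (algebraMap ℂ A c) = 0 := by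
  rw [Function.iterate_succ_apply, D.map_algebraMap, iterate_map_zero]

/-- The coefficient `Dⁿ f / n!` of the exponential of a derivation. -/
noncomputable def expCoeff (n : ℕ) (f : A) : A := (n ! : ℂ)⁻¹ • D^[n] f

theorem expCoeff_mul (n : ℕ) (f g : A) :
    D.expCoeff n (f * g) =
      ∑ ij ∈ Finset.HasAntidiagonal.antidiagonal n, D.expCoeff ij.1 f * D.expCoeff ij.2 g := by
  rw [expCoeff, iterate_mul, Finset.smul_sum]
  refine Finset.sum_congr rfl fun ij hij => ?_
  obtain rfl := Finset.HasAntidiagonal.mem_antidiagonal.mp hij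
  rw [expCoeff, expCoeff, smul_mul_smul_comm, ← _root_.map_natCast (algebraMap ℂ A),
    ← Algebra.smul_def, smul_smul]
  congr 1
  rw [Nat.cast_add_choose]
  have : ((ij.1 + ij.2)! : ℂ) ≠ 0 := by exact_mod_cast Nat.factorial_ne_zero _
  field_simp

theorem expCoeff_add (n : ℕ) (f g : A) :
    D.expCoeff n (f + g) = D.expCoeff n f + D.expCoeff n g := by
  rw [expCoeff, iterate_map_add, smul_add, expCoeff, expCoeff]

@[simp]
theorem expCoeff_zero (f : A) : D.expCoeff 0 f = f := by
  simp [expCoeff]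

theorem expCoeff_algebraMap (n : ℕ) (c : ℂ) :
    D.expCoeff n (algebraMap ℂ A c) = if n = 0 then algebraMap ℂ A c else 0 := by
  cases n with
  | zero => simp
  | succ n => simp only [expCoeff, iterate_succ_algebraMap]; simp

theorem expCoeff_apply (n : ℕ) (f : A) :
    D.expCoeff n (D f) = (n + 1 : ℂ) • D.expCoeff (n + 1) f := by
  rw [expCoeff, expCoeff, smul_smul, Function.iterate_succ_apply]
  congr 1
  rw [Nat.factorial_succ]
  have : (n + 1 : ℂ) ≠ 0 := by exact_mod_cast n.succ_ne_zero
  push_cast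
  field_simp

theorem expCoeff_one (f : A) : D.expCoeff 1 f = D f := by
  simp [expCoeff]

/-- The exponential `f ↦ ∑ Dⁿ f / n! Xⁿ` of a derivation. -/
noncomputable def expHom : A →+* PowerSeries A where
  toFun f := PowerSeries.mk fun n => D.expCoeff n f
  map_one' := by
    ext n
    rw [PowerSeries.coeff_mk, PowerSeries.coeff_one, ← map_one (algebraMap ℂ A),
      expCoeff_algebraMap]
  map_mul' f g := by
    ext n
    simp [PowerSeries.coeff_mul, expCoeff_mul]
  map_zero' := by
    ext n
    rw [PowerSeries.coeff_mk, ← map_zero (algebraMap ℂ A), expCoeff_algebraMap]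
    simp
  map_add' f g := by
    ext n
    simp [expCoeff_add]

theorem iterate_mem {I : Ideal A} (hI : ∀ x ∈ I, D x ∈ I) {f : A} (hf : f ∈ I) (n : ℕ) :
    D^[n] f ∈ I := by
  induction n with
  | zero => exact hf
  | succ n ih => rw [Function.iterate_succ_apply']; exact hI _ ih

theorem expCoeff_mem {I : Ideal A} (hI : ∀ x ∈ I, D x ∈ I) {f : A} (hf : f ∈ I) (n : ℕ) :
    D.expCoeff n f ∈ I :=
  Submodule.smul_of_tower_mem I _ (D.iterate_mem hI hf n)

/-- In characteristic zero, the minimal primes over a differential ideal are differential. -/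
theorem mem_of_mem_minimalPrimes {I Q : Ideal A} (hI : ∀ x ∈ I, D x ∈ I)
    (hQ : Q ∈ I.minimalPrimes) {x : A} (hx : x ∈ Q) : D x ∈ Q := by
  have := hQ.1.1
  let F := (PowerSeries.map (Ideal.Quotient.mk Q)).comp D.expHom
  have hmem (f : A) : f ∈ RingHom.ker F ↔ ∀ n, D.expCoeff n f ∈ Q := by
    rw [RingHom.mem_ker, PowerSeries.ext_iff]
    simp [F, expHom, Ideal.Quotient.eq_zero_iff_mem]
  have hle : RingHom.ker F ≤ Q := fun f hf => by simpa using (hmem f).1 hf 0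
  have hI' : I ≤ RingHom.ker F := fun f hf =>
    (hmem f).2 fun n => hQ.1.2 (D.expCoeff_mem hI hf n)
  have := (hmem x).1 (hQ.2 ⟨RingHom.ker_isPrime F, hI'⟩ hle hx) 1
  rwa [expCoeff_one] at this

end Derivation

/-- `PolyBound s R k K f` says that `f` is a polynomial of degree at most `k` in the elements of `s`
whose `ℓ¹`-norm, with each variable given weight `R`, is at most `K`. -/
inductive PolyBound {A : Type} [CommRing A] [Algebra ℂ A] (s : Finset A) (R : ℝ) :
    ℕ → ℝ → A → Prop
  | const (c : ℂ) : PolyBound s R 0 ‖c‖ (algebraMap ℂ A c)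
  | gen_mul {g f : A} {k : ℕ} {K : ℝ} :
      g ∈ s → PolyBound s R k K f → PolyBound s R (k + 1) (R * K) (g * f)
  | add {f f' : A} {k : ℕ} {K K' : ℝ} :
      PolyBound s R k K f → PolyBound s R k K' f' → PolyBound s R k (K + K') (f + f')
  | mono {f : A} {k k' : ℕ} {K K' : ℝ} :
      k ≤ k' → K ≤ K' → PolyBound s R k K f → PolyBound s R k' K' f

namespace PolyBound

variable {A : Type} [CommRing A] [Algebra ℂ A] {s : Finset A} {R : ℝ}

theorem nonneg (hR : 0 ≤ R) {k : ℕ} {K : ℝ} {f : A} (h : PolyBound s R k K f) : 0 ≤ K := by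
  induction h with
  | const c => exact norm_nonneg c
  | gen_mul _ _ ih => exact mul_nonneg hR ih
  | add _ _ ih ih' => exact add_nonneg ih ih'
  | mono _ hK _ ih => exact ih.trans hK

theorem norm_le (hR : 0 ≤ R) (χ : A →ₐ[ℂ] ℂ) (hχ : ∀ g ∈ s, ‖χ g‖ ≤ R) {k : ℕ} {K : ℝ} {f : A}
    (h : PolyBound s R k K f) : ‖χ f‖ ≤ K := by
  induction h with
  | const c => simp
  | gen_mul hg _ ih =>
    rw [map_mul, norm_mul]
    exact mul_le_mul (hχ _ hg) ih (norm_nonneg _) hR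
  | add _ _ ih ih' =>
    rw [map_add]
    exact (norm_add_le _ _).trans (add_le_add ih ih')
  | mono _ hK _ ih => exact ih.trans hK

theorem algebraMap_mul (c : ℂ) {k : ℕ} {K : ℝ} {f : A} (h : PolyBound s R k K f) :
    PolyBound s R k (‖c‖ * K) (algebraMap ℂ A c * f) := by
  induction h with
  | const c' =>
    rw [← norm_mul, ← map_mul]
    exact const _
  | gen_mul hg _ ih =>
    rw [mul_left_comm, mul_left_comm _ (_ : A)]
    exact gen_mul hg ih
  | add _ _ ih ih' =>
    rw [mul_add, mul_add]
    exact add ih ih'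
  | mono hk hK _ ih => exact mono hk (mul_le_mul_of_nonneg_left hK (norm_nonneg c)) ih

theorem mul (hR : 0 ≤ R) {k k' : ℕ} {K K' : ℝ} {f f' : A} (h : PolyBound s R k K f)
    (h' : PolyBound s R k' K' f') : PolyBound s R (k + k') (K * K') (f * f') := by
  induction h with
  | const c =>
    rw [Nat.zero_add]
    exact h'.algebraMap_mul c
  | gen_mul hg _ ih =>
    rw [mul_assoc, mul_assoc, Nat.add_right_comm]
    exact gen_mul hg ih
  | add _ _ ih ih' =>
    rw [add_mul, add_mul]
    exact add ih ih'
  | mono hk hK _ ih =>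
    exact mono (Nat.add_le_add_right hk _) (mul_le_mul_of_nonneg_right hK (h'.nonneg hR)) ih

theorem of_mem {g : A} (hg : g ∈ s) : PolyBound s R 1 R g := by
  simpa using gen_mul hg (const (s := s) (R := R) 1)

theorem exists_of_adjoin_eq_top (hR : 0 ≤ R) (hs : Algebra.adjoin ℂ (s : Set A) = ⊤) (f : A) :
    ∃ k K, PolyBound s R k K f := by
  have hf : f ∈ Algebra.adjoin ℂ (s : Set A) := hs ▸ Algebra.mem_top
  induction hf using Algebra.adjoin_induction with
  | mem g hg => exact ⟨1, R, of_mem hg⟩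
  | algebraMap c => exact ⟨0, _, const c⟩
  | add f g _ _ ihf ihg =>
    obtain ⟨k, K, h⟩ := ihf
    obtain ⟨k', K', h'⟩ := ihg
    exact ⟨max k k', K + K',
      add (mono (le_max_left _ _) le_rfl h) (mono (le_max_right _ _) le_rfl h')⟩
  | mul f g _ _ ihf ihg =>
    obtain ⟨k, K, h⟩ := ihf
    obtain ⟨k', K', h'⟩ := ihg
    exact ⟨_, _, h.mul hR h'⟩

theorem derivation (hR : 1 ≤ R) (D : Derivation ℂ A A) {d : ℕ} {N : ℝ} (hN : 0 ≤ N)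
    (hD : ∀ g ∈ s, PolyBound s R d N (D g)) {k : ℕ} {K : ℝ} {f : A} (h : PolyBound s R k K f) :
    PolyBound s R (k + d) (k * N * K) (D f) := by
  have hR0 : 0 ≤ R := zero_le_one.trans hR
  induction h with
  | const c =>
    rw [D.map_algebraMap]
    simpa using mono (Nat.zero_le (0 + d)) le_rfl (const (s := s) (R := R) 0)
  | @gen_mul g f k K hg hf ih =>
    rw [D.leibniz, smul_eq_mul, smul_eq_mul]
    have h1 := mono (show k + d ≤ k + 1 + d by omega) le_rfl (hf.mul hR0 (hD g hg))
    have h2 := mono (show k + d + 1 ≤ k + 1 + d by omega) le_rfl (gen_mul hg ih)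
    refine mono le_rfl ?_ (add h2 h1)
    have := mul_nonneg (mul_nonneg hN (hf.nonneg hR0)) (sub_nonneg.2 hR)
    push_cast
    linarith
  | add _ _ ih ih' =>
    rw [map_add, mul_add]
    exact add ih ih'
  | @mono f k k' K K' hk hK hf ih =>
    refine mono (Nat.add_le_add_right hk _) ?_ ih
    have := hf.nonneg hR0
    gcongr

theorem iterate_derivation (hR : 1 ≤ R) (D : Derivation ℂ A A) {d : ℕ} {N : ℝ} (hN : 0 ≤ N)
    (hD : ∀ g ∈ s, PolyBound s R d N (D g)) {g : A} (hg : g ∈ s) (n : ℕ) :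
    PolyBound s R (1 + n * d) (R * (N * (1 + d)) ^ n * n !) (D^[n] g) := by
  induction n with
  | zero => simpa using of_mem hg
  | succ n ih =>
    rw [Function.iterate_succ_apply']
    refine mono (by rw [Nat.succ_mul, add_assoc]) ?_ (ih.derivation hR D hN hD)
    have h : (1 + n * d : ℝ) ≤ (n + 1) * (1 + d) := by
      nlinarith [n.cast_nonneg (α := ℝ), d.cast_nonneg (α := ℝ)]
    have h0 : 0 ≤ R * (N * (1 + d)) ^ n * n ! := by positivity
    calc ((1 + n * d : ℕ) : ℝ) * N * (R * (N * (1 + d)) ^ n * n !)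
        = (1 + n * d : ℝ) * (N * (R * (N * (1 + d)) ^ n * n !)) := by push_cast; ring
      _ ≤ (n + 1) * (1 + d) * (N * (R * (N * (1 + d)) ^ n * n !)) :=
          mul_le_mul_of_nonneg_right h (mul_nonneg hN h0)
      _ = R * (N * (1 + d)) ^ (n + 1) * (n + 1)! := by
          rw [Nat.factorial_succ]
          push_cast
          ring

end PolyBound

namespace Derivation

variable {A : Type} [CommRing A] [Algebra ℂ A] (D : Derivation ℂ A A) (χ : A →ₐ[ℂ] ℂ)

theorem norm_expCoeff (n : ℕ) (f : A) : ‖χ (D.expCoeff n f)‖ = (n ! : ℝ)⁻¹ * ‖χ (D^[n] f)‖ := by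
  rw [expCoeff, _root_.map_smul, norm_smul, norm_inv, Complex.norm_natCast]

theorem map_expCoeff_mul_mul_pow (t : ℂ) (n : ℕ) (f g : A) :
    χ (D.expCoeff n (f * g)) * t ^ n = ∑ ij ∈ Finset.HasAntidiagonal.antidiagonal n,
      (χ (D.expCoeff ij.1 f) * t ^ ij.1) * (χ (D.expCoeff ij.2 g) * t ^ ij.2) := by
  rw [expCoeff_mul, map_sum, Finset.sum_mul]
  refine Finset.sum_congr rfl fun ij hij => ?_
  rw [← Finset.HasAntidiagonal.mem_antidiagonal.mp hij, map_mul, pow_add]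
  ring

theorem summable_expCoeff_algebraMap (c t : ℂ) :
    Summable fun n => ‖χ (D.expCoeff n (algebraMap ℂ A c)) * t ^ n‖ := by
  refine summable_of_ne_finset_zero (s := {0}) fun n hn => ?_
  rw [expCoeff_algebraMap, if_neg (by simpa using hn)]
  simp

/-- The exponential of a derivation at a point of an affine algebra has a positive radius of
convergence, uniformly in the functions it is applied to. -/
theorem exists_summable_expCoeff [Algebra.FiniteType ℂ A] :
    ∃ r : ℝ, 0 < r ∧ ∀ f : A, Summable fun n => ‖χ (D.expCoeff n f) * (r : ℂ) ^ n‖ := by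
  obtain ⟨s, hs⟩ := Algebra.FiniteType.out (R := ℂ) (A := A)
  let R : ℝ := 1 + ∑ g ∈ s, ‖χ g‖
  have hR : 1 ≤ R := le_add_of_nonneg_right (Finset.sum_nonneg fun g _ => norm_nonneg _)
  have hR0 : 0 ≤ R := zero_le_one.trans hR
  have hχ : ∀ g ∈ s, ‖χ g‖ ≤ R := fun g hg =>
    (Finset.single_le_sum (f := fun g => ‖χ g‖) (fun g _ => norm_nonneg _) hg).trans
      (le_add_of_nonneg_left zero_le_one)
  choose k K hkK using PolyBound.exists_of_adjoin_eq_top hR0 hs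
  let d : ℕ := s.sup fun g => k (D g)
  let N : ℝ := ∑ g ∈ s, K (D g)
  have hK : ∀ g ∈ s, 0 ≤ K (D g) := fun g _ => (hkK (D g)).nonneg hR0
  have hN : 0 ≤ N := Finset.sum_nonneg hK
  have hD : ∀ g ∈ s, PolyBound s R d N (D g) := fun g hg =>
    PolyBound.mono (Finset.le_sup (f := fun g => k (D g)) hg)
      (Finset.single_le_sum (f := fun g => K (D g)) hK hg) (hkK (D g))
  let C : ℝ := N * (1 + d)
  have hC : 0 ≤ C := by positivity
  have hr : 0 < (C + 1)⁻¹ := by positivity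
  refine ⟨(C + 1)⁻¹, hr, fun f => ?_⟩
  have hf : f ∈ Algebra.adjoin ℂ (s : Set A) := hs ▸ Algebra.mem_top
  induction hf using Algebra.adjoin_induction with
  | mem g hg =>
    have hlt : C * (C + 1)⁻¹ < 1 := by
      rw [← div_eq_mul_inv, div_lt_one (by positivity)]
      exact lt_add_one C
    refine Summable.of_nonneg_of_le (fun n => norm_nonneg _) (fun n => ?_)
      ((summable_geometric_of_lt_one (by positivity) hlt).mul_left R)
    have hb := (PolyBound.iterate_derivation hR D hN hD hg n).norm_le hR0 χ hχ
    rw [norm_mul, norm_expCoeff, norm_pow, Complex.norm_real, Real.norm_of_nonneg hr.le, mul_pow,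
      ← mul_assoc]
    refine mul_le_mul_of_nonneg_right ?_ (by positivity)
    rw [inv_mul_le_iff₀ (by positivity), mul_comm]
    exact hb
  | algebraMap c => exact D.summable_expCoeff_algebraMap χ c _
  | add f g _ _ ihf ihg =>
    refine Summable.of_nonneg_of_le (fun n => norm_nonneg _) (fun n => ?_) (ihf.add ihg)
    rw [expCoeff_add, map_add, add_mul]
    exact norm_add_le _ _
  | mul f g _ _ ihf ihg =>
    refine (summable_norm_sum_mul_antidiagonal_of_summable_norm ihf ihg).congr fun n => ?_
    rw [map_expCoeff_mul_mul_pow]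

variable {D χ} {r : ℝ}

theorem summable_expCoeff_of_norm_le
    (hr : ∀ f : A, Summable fun n => ‖χ (D.expCoeff n f) * (r : ℂ) ^ n‖) {t : ℂ} (ht : ‖t‖ ≤ r)
    (f : A) : Summable fun n => ‖χ (D.expCoeff n f) * t ^ n‖ := by
  refine Summable.of_nonneg_of_le (fun n => norm_nonneg _) (fun n => ?_) (hr f)
  rw [norm_mul, norm_mul, norm_pow, norm_pow, Complex.norm_real]
  gcongr
  exact ht.trans (le_abs_self r)

variable (D χ) in
/-- The value at time `t` of the flow of `D` through the point `χ`, evaluated on `f`. -/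
noncomputable def flowFun (t : ℂ) (f : A) : ℂ := ∑' n, χ (D.expCoeff n f) * t ^ n

theorem flowFun_zero (f : A) : D.flowFun χ 0 f = χ f := by
  rw [flowFun, tsum_eq_single 0 fun n hn => by simp [hn]]
  simp

/-- The point reached at time `t` by the flow of `D` through the point `χ`. -/
noncomputable def flow (hr : ∀ f : A, Summable fun n => ‖χ (D.expCoeff n f) * (r : ℂ) ^ n‖)
    (t : ℂ) (ht : ‖t‖ ≤ r) : A →ₐ[ℂ] ℂ :=
  have halg (c : ℂ) : D.flowFun χ t (algebraMap ℂ A c) = c := by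
    rw [flowFun, tsum_eq_single 0 fun n hn => by rw [expCoeff_algebraMap, if_neg hn]; simp]
    simp
  { toFun := D.flowFun χ t
    map_one' := by simpa using halg 1
    map_mul' := fun f g => by
      simp only [flowFun, map_expCoeff_mul_mul_pow]
      exact (tsum_mul_tsum_eq_tsum_sum_antidiagonal_of_summable_norm
        (summable_expCoeff_of_norm_le hr ht f) (summable_expCoeff_of_norm_le hr ht g)).symm
    map_zero' := by simpa using halg 0
    map_add' := fun f g => by
      simp only [flowFun, expCoeff_add, map_add, add_mul]
      exact (summable_expCoeff_of_norm_le hr ht f).of_norm.tsum_add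
        (summable_expCoeff_of_norm_le hr ht g).of_norm
    commutes' := halg }

theorem flow_apply (hr : ∀ f : A, Summable fun n => ‖χ (D.expCoeff n f) * (r : ℂ) ^ n‖)
    (t : ℂ) (ht : ‖t‖ ≤ r) (f : A) : flow hr t ht f = D.flowFun χ t f := rfl

theorem hasDerivAt_flowFun (hr0 : 0 < r)
    (hr : ∀ f : A, Summable fun n => ‖χ (D.expCoeff n f) * (r : ℂ) ^ n‖)
    {t : ℂ} (ht : t ∈ Metric.ball (0 : ℂ) r) (f : A) :
    HasDerivAt (fun t => D.flowFun χ t f) (D.flowFun χ t (D f)) t := by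
  have hterm (n : ℕ) (y : ℂ) : χ (D.expCoeff (n + 1) f) * ((n + 1 : ℕ) * y ^ n) =
      χ (D.expCoeff n (D f)) * y ^ n := by
    rw [expCoeff_apply, _root_.map_smul, smul_eq_mul]
    push_cast
    ring
  have key := hasDerivAt_tsum_of_isPreconnected
    (g := fun n y => χ (D.expCoeff n f) * y ^ n)
    (g' := fun n y => χ (D.expCoeff n f) * (n * y ^ (n - 1)))
    (u := fun n => ‖χ (D.expCoeff n f) * (n * (r : ℂ) ^ (n - 1))‖) (y₀ := 0)
    ?_ Metric.isOpen_ball (convex_ball (0 : ℂ) r).isPreconnected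
    (fun n y _ => (hasDerivAt_pow n y).const_mul _) (fun n y hy => ?_)
    (Metric.mem_ball_self hr0) ?_ ht
  · refine key.congr_deriv ?_
    have hs := (summable_expCoeff_of_norm_le hr (mem_ball_zero_iff.1 ht).le (D f)).of_norm
    simp only [← hterm] at hs
    rw [Summable.tsum_eq_zero_add ((summable_nat_add_iff 1).1 (by simpa using hs)), flowFun]
    simp only [← hterm]
    simp
  · refine (summable_nat_add_iff 1).1 ?_
    simpa only [Nat.add_sub_cancel, hterm] using hr (D f)
  · simp only [norm_mul, norm_pow, Complex.norm_real]
    have := (mem_ball_zero_iff.1 hy).le.trans (le_abs_self r)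
    gcongr
    exact this
  · exact (summable_expCoeff_of_norm_le hr (by simpa using hr0.le) f).of_norm

theorem iteratedDeriv_flowFun (hr0 : 0 < r)
    (hr : ∀ f : A, Summable fun n => ‖χ (D.expCoeff n f) * (r : ℂ) ^ n‖)
    {t : ℂ} (ht : t ∈ Metric.ball (0 : ℂ) r) (n : ℕ) (f : A) :
    iteratedDeriv n (fun t => D.flowFun χ t f) t = D.flowFun χ t (D^[n] f) := by
  induction n generalizing f t with
  | zero => simp
  | succ n ih =>
    rw [iteratedDeriv_succ, Function.iterate_succ_apply', ← (hasDerivAt_flowFun hr0 hr ht _).deriv]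
    refine Filter.EventuallyEq.deriv_eq ?_
    filter_upwards [Metric.isOpen_ball.mem_nhds ht] with y hy using ih hy f

theorem flowFun_eq_zero (hr0 : 0 < r)
    (hr : ∀ f : A, Summable fun n => ‖χ (D.expCoeff n f) * (r : ℂ) ^ n‖)
    {t : ℂ} (ht : t ∈ Metric.ball (0 : ℂ) r) {f : A} (hf : ∀ n, D.flowFun χ t (D^[n] f) = 0) :
    χ f = 0 := by
  have hdiff : DifferentiableOn ℂ (fun t => D.flowFun χ t f) (Metric.ball 0 r) := fun y hy =>
    (hasDerivAt_flowFun hr0 hr hy f).differentiableAt.differentiableWithinAt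
  obtain ⟨ε, hε, hball⟩ := Metric.isOpen_iff.1 Metric.isOpen_ball t ht
  have hloc : (fun t => D.flowFun χ t f) =ᶠ[𝓝 t] 0 := by
    filter_upwards [Metric.ball_mem_nhds t hε] with y hy
    have h := Complex.taylorSeries_eq_on_ball' hy (hdiff.mono hball)
    simp only [iteratedDeriv_flowFun hr0 hr ht, hf] at h
    simpa using h.symm
  have := (hdiff.analyticOnNhd Metric.isOpen_ball).eqOn_zero_of_preconnected_of_eventuallyEq_zero
    (convex_ball (0 : ℂ) r).isPreconnected ht hloc (Metric.mem_ball_self hr0)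
  simpa [flowFun_zero] using this

end Derivation

section PoissonCore

variable {A : Type} [CommRing A] [Algebra ℂ A] {br : A →ₗ[ℂ] A →ₗ[ℂ] A}

/-- The Hamiltonian derivation `{a, -}`. -/
def hamiltonian (hleibniz : ∀ a b c : A, br a (b * c) = br a b * c + b * br a c) (a : A) :
    Derivation ℂ A A :=
  Derivation.mk' (br a) fun b c => by
    rw [hleibniz, smul_eq_mul, smul_eq_mul, mul_comm _ c, add_comm]

theorem hamiltonian_apply (hleibniz : ∀ a b c : A, br a (b * c) = br a b * c + b * br a c)
    (a b : A) : hamiltonian hleibniz a b = br a b := rfl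

theorem poissonCore_le (J : Ideal A) : poissonCore A br J ≤ J :=
  sSup_le fun _ hI => hI.2

theorem le_poissonCore {I J : Ideal A} (hI : IsPoissonIdeal A br I) (hIJ : I ≤ J) :
    I ≤ poissonCore A br J :=
  le_sSup ⟨hI, hIJ⟩

theorem isPoissonIdeal_poissonCore
    (hleibniz : ∀ a b c : A, br a (b * c) = br a b * c + b * br a c) (J : Ideal A) :
    IsPoissonIdeal A br (poissonCore A br J) := by
  intro a x hx
  let S := poissonCore A br J
  let T : Ideal A :=
    { carrier := {x | x ∈ S ∧ br a x ∈ S}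
      add_mem' := fun hx hy => ⟨S.add_mem hx.1 hy.1, by
        rw [map_add]
        exact S.add_mem hx.2 hy.2⟩
      zero_mem' := ⟨S.zero_mem, by
        rw [map_zero]
        exact S.zero_mem⟩
      smul_mem' := fun c y hy => ⟨S.smul_mem c hy.1, by
        rw [smul_eq_mul, hleibniz]
        exact S.add_mem (S.mul_mem_left _ hy.1) (S.mul_mem_left _ hy.2)⟩ }
  have hle : S ≤ T := sSup_le fun I hI y hy =>
    ⟨le_poissonCore hI.1 hI.2 hy, le_poissonCore hI.1 hI.2 (hI.1 a y hy)⟩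
  exact (hle hx).2

theorem poissonCore_isPrime
    (hleibniz : ∀ a b c : A, br a (b * c) = br a b * c + b * br a c) (P : Ideal A) [P.IsPrime] :
    (poissonCore A br P).IsPrime := by
  obtain ⟨Q, hQ, hQP⟩ := Ideal.exists_minimalPrimes_le (poissonCore_le (br := br) P)
  have hQ' : IsPoissonIdeal A br Q := fun a x hx =>
    (hamiltonian hleibniz a).mem_of_mem_minimalPrimes
      (isPoissonIdeal_poissonCore hleibniz P a) hQ hx
  rw [(hQ.1.2.antisymm (le_poissonCore hQ' hQP) : poissonCore A br P = Q)]
  exact hQ.1.1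

theorem poissonCore_ker_flow
    (hleibniz : ∀ a b c : A, br a (b * c) = br a b * c + b * br a c) (a : A) {χ : A →ₐ[ℂ] ℂ}
    {r : ℝ} (hr0 : 0 < r)
    (hr : ∀ f : A, Summable fun n =>
      ‖χ ((hamiltonian hleibniz a).expCoeff n f) * (r : ℂ) ^ n‖)
    {t : ℂ} (ht : t ∈ Metric.ball (0 : ℂ) r) :
    poissonCore A br (RingHom.ker (Derivation.flow hr t (mem_ball_zero_iff.1 ht).le)) =
      poissonCore A br (RingHom.ker χ) := by
  refine le_antisymm ?_ ?_ <;> refine le_poissonCore (isPoissonIdeal_poissonCore hleibniz _) ?_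
  · intro f hf
    refine RingHom.mem_ker.2 (Derivation.flowFun_eq_zero hr0 hr ht fun n => ?_)
    exact RingHom.mem_ker.1 (poissonCore_le _
      ((hamiltonian hleibniz a).iterate_mem (isPoissonIdeal_poissonCore hleibniz _ a) hf n))
  · intro f hf
    rw [RingHom.mem_ker, Derivation.flow_apply, Derivation.flowFun]
    refine (tsum_congr fun n => ?_).trans tsum_zero
    rw [RingHom.mem_ker.1 (poissonCore_le _
      ((hamiltonian hleibniz a).expCoeff_mem (isPoissonIdeal_poissonCore hleibniz _ a) hf n)),
      zero_mul]

theorem AlgHom.ker_isMaximal_of_field {k A : Type*} [Field k] [CommRing A] [Algebra k A]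
    (χ : A →ₐ[k] k) :
    (RingHom.ker χ).IsMaximal :=
  RingHom.ker_isMaximal_of_surjective χ fun z => ⟨algebraMap k A z, by simp⟩

theorem Ideal.IsMaximal.exists_ker_eq {k A : Type*} [Field k] [IsAlgClosed k] [CommRing A]
    [Algebra k A] [Algebra.FiniteType k A]
    {M : Ideal A} (hM : M.IsMaximal) : ∃ χ : A →ₐ[k] k, RingHom.ker χ = M := by
  let _ : Field (A ⧸ M) := Ideal.Quotient.field M
  have : Module.Finite k (A ⧸ M) := finite_of_finite_type_of_isJacobsonRing k (A ⧸ M)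
  let e : k ≃ₐ[k] A ⧸ M := AlgEquiv.ofBijective (Algebra.ofId k (A ⧸ M))
    IsAlgClosed.algebraMap_bijective_of_isIntegral
  refine ⟨(e.symm : (A ⧸ M) →ₐ[k] k).comp (Ideal.Quotient.mkₐ k M), ?_⟩
  ext x
  simp [RingHom.mem_ker, Ideal.Quotient.eq_zero_iff_mem]

/-- The ideal of the symplectic core of a point is the Poisson core of that point: a function
vanishing at all points with the same Poisson core as `M` lies in the Poisson core of `M`. -/
theorem mem_poissonCore_of_forall_maximal [Algebra.FiniteType ℂ A]
    (hleibniz : ∀ a b c : A, br a (b * c) = br a b * c + b * br a c) {M : Ideal A}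
    (hM : M.IsMaximal) {f : A}
    (hf : ∀ M' : Ideal A, M'.IsMaximal → poissonCore A br M' = poissonCore A br M → f ∈ M') :
    f ∈ poissonCore A br M := by
  let J : Ideal A := sInf {M' | M'.IsMaximal ∧ poissonCore A br M' = poissonCore A br M}
  have hJ : IsPoissonIdeal A br J := by
    intro a x hx
    refine Ideal.mem_sInf.2 fun {M'} hM' => ?_
    obtain ⟨χ, rfl⟩ := hM'.1.exists_ker_eq (k := ℂ)
    obtain ⟨r, hr0, hr⟩ := (hamiltonian hleibniz a).exists_summable_expCoeff χ
    have h0 : ∀ t ∈ Metric.ball (0 : ℂ) r, (hamiltonian hleibniz a).flowFun χ t x = 0 :=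
      fun t ht => RingHom.mem_ker.1 (Ideal.mem_sInf.1 hx
        ⟨AlgHom.ker_isMaximal_of_field (Derivation.flow hr t (mem_ball_zero_iff.1 ht).le),
          (poissonCore_ker_flow hleibniz a hr0 hr ht).trans hM'.2⟩)
    have hmem := Metric.mem_ball_self (x := (0 : ℂ)) hr0
    have hd := Derivation.hasDerivAt_flowFun hr0 hr hmem x
    have hz : HasDerivAt (fun t => (hamiltonian hleibniz a).flowFun χ t x) 0 0 :=
      (hasDerivAt_const (0 : ℂ) (0 : ℂ)).congr_of_eventuallyEq <| by
        filter_upwards [Metric.isOpen_ball.mem_nhds hmem] with t ht using h0 t ht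
    rw [RingHom.mem_ker, ← hamiltonian_apply hleibniz, ← Derivation.flowFun_zero]
    exact hd.unique hz
  exact le_poissonCore hJ (sInf_le ⟨hM, rfl⟩) (Ideal.mem_sInf.2 fun {M'} hM' => hf M' hM'.1 hM'.2)

/-- The Poisson core of `M` contains `s` iff `M` contains the Poisson ideal generated by `s`. -/
theorem subset_poissonCore_iff
    (hleibniz : ∀ a b c : A, br a (b * c) = br a b * c + b * br a c) (s : Set A) (M : Ideal A) :
    s ⊆ poissonCore A br M ↔ sInf {I : Ideal A | IsPoissonIdeal A br I ∧ s ⊆ I} ≤ M := by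
  constructor
  · intro h
    have hmem : poissonCore A br M ∈ {I : Ideal A | IsPoissonIdeal A br I ∧ s ⊆ I} :=
      ⟨isPoissonIdeal_poissonCore hleibniz M, h⟩
    exact (sInf_le hmem).trans (poissonCore_le M)
  · intro h f hf
    refine le_poissonCore (fun a x hx => ?_) h (Ideal.mem_sInf.2 fun {I} hI => hI.2 hf)
    exact Ideal.mem_sInf.2 fun {I} hI => hI.1 a x (Ideal.mem_sInf.1 hx hI)

end PoissonCore

/-- The Poisson core of a maximal ideal is prime, and the map `π_m : Max A → P.prim A` sending a
maximal ideal to its Poisson core is a continuous surjection realizing `P.prim A` as a topological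
quotient of `Max A`: a subset `X ⊆ P.prim A` is closed iff `π_m⁻¹(X)` is closed in `Max A`. -/
theorem poissonPrim_topological_quotient (A : Type) [CommRing A] [Algebra ℂ A]
    [Algebra.FiniteType ℂ A]
    (br : A →ₗ[ℂ] A →ₗ[ℂ] A)
    (hanti : ∀ a b : A, br a b = -br b a)
    (hjacobi : ∀ a b c : A, br a (br b c) = br (br a b) c + br b (br a c))
    (hleibniz : ∀ a b c : A, br a (b * c) = br a b * c + b * br a c) :
    (∀ M : MaximalSpectrum A, (poissonCore A br M.asIdeal).IsPrime) ∧
    ∀ πm : MaximalSpectrum A → {P : PrimeSpectrum A // IsPoissonPrimitive A br P.asIdeal},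
      (∀ M, (πm M).1.asIdeal = poissonCore A br M.asIdeal) →
      Continuous πm ∧ Function.Surjective πm ∧
      ∀ X : Set {P : PrimeSpectrum A // IsPoissonPrimitive A br P.asIdeal},
        (IsClosed X ↔ IsClosed (πm ⁻¹' X)) := by
  refine ⟨fun M => poissonCore_isPrime hleibniz M.asIdeal, fun πm hπ => ?_⟩
  have hcont : Continuous πm := by
    refine continuous_iff_isClosed.2 fun X hX => ?_
    obtain ⟨Z, hZ, rfl⟩ := isClosed_induced_iff.1 hX
    obtain ⟨s, rfl⟩ := (PrimeSpectrum.isClosed_iff_zeroLocus Z).1 hZ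
    refine isClosed_induced_iff.2 ⟨_, PrimeSpectrum.isClosed_zeroLocus
      (sInf {I : Ideal A | IsPoissonIdeal A br I ∧ s ⊆ I} : Ideal A), ?_⟩
    ext M
    have := subset_poissonCore_iff hleibniz s M.asIdeal
    rw [← hπ] at this
    exact this.symm
  refine ⟨hcont, ?_, fun X => ⟨fun hX => hX.preimage hcont, fun hX => ?_⟩⟩
  · rintro ⟨P, M, hM, hP⟩
    exact ⟨⟨M, hM⟩, Subtype.ext (PrimeSpectrum.ext ((hπ _).trans hP))⟩
  · obtain ⟨Z, hZ, hZX⟩ := isClosed_induced_iff.1 hX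
    obtain ⟨s, rfl⟩ := (PrimeSpectrum.isClosed_iff_zeroLocus Z).1 hZ
    have hmem (M : MaximalSpectrum A) : s ⊆ M.asIdeal ↔ πm M ∈ X := Set.ext_iff.1 hZX M
    refine isClosed_induced_iff.2 ⟨_, PrimeSpectrum.isClosed_zeroLocus s, ?_⟩
    ext P
    obtain ⟨M, hM, hP⟩ := P.2
    have hMP : πm ⟨M, hM⟩ = P := Subtype.ext (PrimeSpectrum.ext ((hπ _).trans hP))
    change s ⊆ P.1.asIdeal ↔ P ∈ X
    refine ⟨fun h => ?_, fun h f hf => ?_⟩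
    · rw [← hMP, ← hmem]
      rw [← hP] at h
      exact h.trans (poissonCore_le M)
    · rw [← hP]
      refine mem_poissonCore_of_forall_maximal hleibniz hM fun M' hM' hcore => ?_
      have hMP' : πm ⟨M', hM'⟩ = P :=
        Subtype.ext (PrimeSpectrum.ext ((hπ _).trans (hcore.trans hP)))
      exact (hmem ⟨M', hM'⟩).2 (hMP'.symm ▸ h) hf
end
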